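/- Let μ be an isotropic log-concave probability measure on ℝ^n and let A ⊂ ℝ^n be a symmetric convex body (A = −A). Then μ⁺(∂A) ≤ 4n. Consequently Γ^{(s)}(μ) := sup{μ⁺(∂A) : A symmetric convex body} ≤ 4n. -/

import Mathlib

open MeasureTheory Metric Filter Set Pointwise

noncomputable section

abbrev Euc (n : ℕ) := EuclideanSpace ℝ (Fin n)

/-- `f` is a log-concave (nonnegative) function on `ℝ^n`. -/
def IsLogConcaveFn {n : ℕ} (f : Euc n → ℝ) : Prop :=
  (∀ x, 0 ≤ f x) ∧
  ∀ x y : Euc n, ∀ τ : ℝ, 0 ≤ τ → τ ≤ 1 →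
    f x ^ τ * f y ^ (1 - τ) ≤ f (τ • x + (1 - τ) • y)

/-- The `μ`-perimeter `μ⁺(∂A) = liminf_{ε→0⁺} μ((A + εB₂ⁿ) \ A) / ε`. -/
def muPerim {n : ℕ} (μ : Measure (Euc n)) (A : Set (Euc n)) : ℝ :=
  liminf (fun ε : ℝ => (μ ((A + closedBall (0 : Euc n) ε) \ A)).toReal / ε)
    (nhdsWithin 0 (Ioi 0))

/-- A convex body: compact convex set with nonempty interior. -/
def IsConvexBody {n : ℕ} (A : Set (Euc n)) : Prop :=
  Convex ℝ A ∧ IsCompact A ∧ (interior A).Nonempty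

open scoped ENNReal

/-- Log-concavity for extended nonnegative functions. -/
def LC {E : Type*} [AddCommGroup E] [Module ℝ E] (f : E → ℝ≥0∞) : Prop :=
  ∀ x y : E, ∀ τ : ℝ, 0 < τ → τ < 1 →
    f x ^ τ * f y ^ (1 - τ) ≤ f (τ • x + (1 - τ) • y)

lemma layer_const (c : ℝ≥0∞) :
    ∫⁻ t in Ioi (0:ℝ), (if ENNReal.ofReal t < c then (1:ℝ≥0∞) else 0) = c := by
  have h1 : (fun t : ℝ => if ENNReal.ofReal t < c then (1:ℝ≥0∞) else 0)
      = {t : ℝ | ENNReal.ofReal t < c}.indicator (fun _ => 1) := by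
    ext t; simp [Set.indicator_apply]
  have hm : MeasurableSet {t : ℝ | ENNReal.ofReal t < c} :=
    measurableSet_lt ENNReal.measurable_ofReal measurable_const
  rw [h1, lintegral_indicator hm, lintegral_const, one_mul, Measure.restrict_apply_univ,
    Measure.restrict_apply hm]
  rcases eq_or_ne c ⊤ with rfl | hc
  · simp
  · have : {t : ℝ | ENNReal.ofReal t < c} ∩ Ioi 0 = Ioo 0 c.toReal := by
      ext t
      simp only [mem_inter_iff, mem_ofPred_eq, mem_Ioi, mem_Ioo]
      constructor
      · rintro ⟨h, h0⟩
        exact ⟨h0, (ENNReal.ofReal_lt_iff_lt_toReal h0.le hc).1 h⟩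
      · rintro ⟨h0, h⟩
        exact ⟨(ENNReal.ofReal_lt_iff_lt_toReal h0.le hc).2 h, h0⟩
    rw [this, Real.volume_Ioo, sub_zero, ENNReal.ofReal_toReal hc]

lemma layercake_enn {u : ℝ → ℝ≥0∞} (hu : Measurable u) :
    ∫⁻ x, u x = ∫⁻ t in Ioi (0:ℝ), volume {x | ENNReal.ofReal t < u x} := by
  calc ∫⁻ x, u x = ∫⁻ x, ∫⁻ t in Ioi (0:ℝ), (if ENNReal.ofReal t < u x then (1:ℝ≥0∞) else 0) := by
        simp_rw [layer_const]
    _ = ∫⁻ t in Ioi (0:ℝ), ∫⁻ x, (if ENNReal.ofReal t < u x then (1:ℝ≥0∞) else 0) := by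
        apply lintegral_lintegral_swap
        apply Measurable.aemeasurable
        apply Measurable.ite _ measurable_const measurable_const
        exact measurableSet_lt (ENNReal.measurable_ofReal.comp measurable_snd)
          (hu.comp measurable_fst)
    _ = _ := by
        congr 1; ext t
        have hm : MeasurableSet {x : ℝ | ENNReal.ofReal t < u x} :=
          measurableSet_lt measurable_const hu
        rw [← lintegral_indicator_one hm]
        congr 1; ext x; simp [Set.indicator_apply]

lemma ediam_le_volume {C : Set ℝ} (hC : C.OrdConnected) : ediam C ≤ volume C := by
  apply ediam_le
  intro x hx y hy
  have := measure_mono (μ := volume) (hC.uIcc_subset hx hy)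
  rwa [Real.volume_interval, abs_sub_comm, ← Real.dist_eq, ← edist_dist] at this

lemma bm_one {A B C : Set ℝ} (hA : A.Nonempty) (hB : B.Nonempty) (hC : C.OrdConnected)
    {τ : ℝ} (h0 : 0 < τ) (h1 : τ < 1)
    (h : ∀ x ∈ A, ∀ y ∈ B, τ * x + (1 - τ) * y ∈ C) :
    ENNReal.ofReal τ * volume A + ENNReal.ofReal (1 - τ) * volume B ≤ volume C := by
  have key : ∀ x ∈ A, ∀ y ∈ A, ∀ z ∈ B, ∀ w ∈ B,
      ENNReal.ofReal τ * edist x y + ENNReal.ofReal (1 - τ) * edist z w ≤ volume C := by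
    have aux : ∀ x ∈ A, ∀ y ∈ A, ∀ z ∈ B, ∀ w ∈ B, x ≤ y → z ≤ w →
      ENNReal.ofReal τ * edist x y + ENNReal.ofReal (1 - τ) * edist z w ≤ volume C := by
      intro x hx y hy z hz w hw hxy hzw
      refine le_trans ?_ (measure_mono (μ := volume) (hC.out (h x hx z hz) (h y hy w hw)))
      rw [Real.volume_Icc, edist_dist, edist_dist, ← ENNReal.ofReal_mul h0.le,
        ← ENNReal.ofReal_mul (by linarith), ← ENNReal.ofReal_add
          (by positivity) (mul_nonneg (by linarith) dist_nonneg)]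
      apply ENNReal.ofReal_le_ofReal
      rw [dist_comm x y, dist_comm z w, Real.dist_eq, Real.dist_eq, abs_of_nonneg (by linarith),
        abs_of_nonneg (by linarith)]
      linarith
    intro x hx y hy z hz w hw
    rcases le_total x y with hxy | hxy <;> rcases le_total z w with hzw | hzw
    · exact aux x hx y hy z hz w hw hxy hzw
    · rw [edist_comm z w]; exact aux x hx y hy w hw z hz hxy hzw
    · rw [edist_comm x y]; exact aux y hy x hx z hz w hw hxy hzw
    · rw [edist_comm x y, edist_comm z w]; exact aux y hy x hx w hw z hz hxy hzw
  calc ENNReal.ofReal τ * volume A + ENNReal.ofReal (1 - τ) * volume B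
      ≤ ENNReal.ofReal τ * ediam A + ENNReal.ofReal (1 - τ) * ediam B := by
        gcongr <;> exact Real.volume_le_diam _
    _ ≤ volume C := by
        unfold ediam
        have : Nonempty A := hA.to_subtype
        have : Nonempty B := hB.to_subtype
        simp only [iSup_subtype', ENNReal.mul_iSup, ENNReal.iSup_add, ENNReal.add_iSup]
        simp only [iSup_le_iff]
        intro w z y x
        exact key _ y.2 _ x.2 _ w.2 _ z.2

lemma lintegral_norm_cut {u : ℝ → ℝ≥0∞} (hu : Measurable u) (h1 : ∀ x, u x ≤ 1) :
    ∫⁻ x, u x = ∫⁻ t in Ioo (0:ℝ) 1, volume {x | ENNReal.ofReal t < u x} := by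
  rw [layercake_enn hu]
  have : Ioi (0:ℝ) = Ioo 0 1 ∪ Ici 1 := by
    ext t; simp only [mem_Ioi, mem_union, mem_Ioo, mem_Ici]
    constructor
    · intro h; rcases lt_or_ge t 1 with h' | h'
      · exact Or.inl ⟨h, h'⟩
      · exact Or.inr h'
    · rintro (h | h); exacts [h.1, by linarith]
  rw [this, lintegral_union measurableSet_Ici]
  · have : ∫⁻ t in Ici (1:ℝ), volume {x | ENNReal.ofReal t < u x} = 0 := by
      rw [setLIntegral_congr_fun (g := fun _ => 0) measurableSet_Ici]
      · simp
      · intro t ht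
        have : {x | ENNReal.ofReal t < u x} = ∅ := by
          ext x
          simp only [mem_ofPred_eq, mem_empty_iff_false, iff_false, not_lt]
          refine (h1 x).trans ?_
          rw [← ENNReal.ofReal_one]
          exact ENNReal.ofReal_le_ofReal ht
        simp [this]
    rw [this, add_zero]
  · rw [Set.disjoint_left]; rintro t ht ht'; exact absurd ht.2 (not_lt.2 ht')

lemma ofReal_add_one_sub {τ : ℝ} (h0 : 0 < τ) (h1 : τ < 1) (a : ℝ≥0∞) :
    a ^ τ * a ^ (1 - τ) = a := by
  rw [← ENNReal.rpow_add_of_nonneg _ _ h0.le (by linarith)]; simp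

lemma pl_norm {u v w : ℝ → ℝ≥0∞} (hu : Measurable u) (hv : Measurable v) (hw : Measurable w)
    (hwc : ∀ t, {x | t < w x}.OrdConnected) {τ : ℝ} (h0 : 0 < τ) (h1 : τ < 1)
    (h : ∀ x y, u x ^ τ * v y ^ (1 - τ) ≤ w (τ * x + (1 - τ) * y))
    (hu1 : ⨆ x, u x = 1) (hv1 : ⨆ x, v x = 1) :
    ENNReal.ofReal τ * (∫⁻ x, u x) + ENNReal.ofReal (1 - τ) * (∫⁻ x, v x) ≤ ∫⁻ x, w x := by
  have mu : ∀ {g : ℝ → ℝ≥0∞}, Measurable g →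
      Measurable (fun t : ℝ => volume {x | ENNReal.ofReal t < g x}) := by
    intro g hg
    apply Antitone.measurable
    intro s t hst
    apply measure_mono
    intro x hx
    exact lt_of_le_of_lt (ENNReal.ofReal_le_ofReal hst) hx
  rw [lintegral_norm_cut hu (fun x => hu1 ▸ le_iSup u x),
    lintegral_norm_cut hv (fun x => hv1 ▸ le_iSup v x)]
  rw [← lintegral_const_mul _ (mu hu), ← lintegral_const_mul _ (mu hv),
    ← lintegral_add_left ((mu hu).const_mul _)]
  refine le_trans (b := ∫⁻ t in Ioo (0:ℝ) 1, volume {x | ENNReal.ofReal t < w x}) ?_ ?_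
  · apply setLIntegral_mono (mu hw)
    intro t ht
    have ht1 : ENNReal.ofReal t < 1 := by
      rw [← ENNReal.ofReal_one]; exact (ENNReal.ofReal_lt_ofReal_iff one_pos).2 ht.2
    apply bm_one _ _ (hwc _) h0 h1
    · intro x hx y hy
      refine lt_of_lt_of_le ?_ (h x y)
      rw [← ofReal_add_one_sub h0 h1 (ENNReal.ofReal t)]
      exact ENNReal.mul_lt_mul (ENNReal.rpow_lt_rpow hx h0)
        (ENNReal.rpow_lt_rpow hy (by linarith))
    · rw [← hu1] at ht1
      exact lt_iSup_iff.1 ht1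
    · rw [← hv1] at ht1
      exact lt_iSup_iff.1 ht1
  · rw [layercake_enn hw]
    exact lintegral_mono_set (fun t ht => ht.1)

lemma amgm_enn (a b : ℝ≥0∞) {τ : ℝ} (h0 : 0 < τ) (h1 : τ < 1) :
    a ^ τ * b ^ (1 - τ) ≤ ENNReal.ofReal τ * a + ENNReal.ofReal (1 - τ) * b := by
  have h1' : 0 < 1 - τ := by linarith
  have hpq : (τ⁻¹).HolderConjugate ((1 - τ)⁻¹) := by
    constructor
    · simp
    · positivity
    · positivity
  have := ENNReal.young_inequality (a ^ τ) (b ^ (1 - τ)) hpq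
  rw [← ENNReal.rpow_mul, ← ENNReal.rpow_mul, mul_inv_cancel₀ h0.ne', mul_inv_cancel₀ h1'.ne',
    ENNReal.rpow_one, ENNReal.rpow_one, ENNReal.ofReal_inv_of_pos h0,
    ENNReal.ofReal_inv_of_pos h1', ENNReal.div_eq_inv_mul, ENNReal.div_eq_inv_mul, inv_inv,
    inv_inv] at this
  exact this

lemma pl_bdd {u v w : ℝ → ℝ≥0∞} (hu : Measurable u) (hv : Measurable v) (hw : Measurable w)
    (hwc : ∀ t, {x | t < w x}.OrdConnected) {τ : ℝ} (h0 : 0 < τ) (h1 : τ < 1)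
    (h : ∀ x y, u x ^ τ * v y ^ (1 - τ) ≤ w (τ * x + (1 - τ) * y))
    (hu1 : ⨆ x, u x ≠ ⊤) (hv1 : ⨆ x, v x ≠ ⊤) :
    (∫⁻ x, u x) ^ τ * (∫⁻ x, v x) ^ (1 - τ) ≤ ∫⁻ x, w x := by
  have h1' : 0 < 1 - τ := by linarith
  set a := ⨆ x, u x with ha
  set b := ⨆ x, v x with hb
  rcases eq_or_ne a 0 with ha0 | ha0
  · have : ∀ x, u x = 0 := fun x => le_antisymm (ha0 ▸ le_iSup u x) bot_le
    simp [this, h0]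
  rcases eq_or_ne b 0 with hb0 | hb0
  · have : ∀ x, v x = 0 := fun x => le_antisymm (hb0 ▸ le_iSup v x) bot_le
    simp [this, h1]
  set c := a ^ τ * b ^ (1 - τ) with hc
  have hc0 : c ≠ 0 := by
    simp [hc, ha0, hb0, hu1, hv1]
  have hct : c ≠ ⊤ := ENNReal.mul_ne_top (ENNReal.rpow_ne_top_of_nonneg h0.le hu1)
    (ENNReal.rpow_ne_top_of_nonneg h1'.le hv1)
  have hci : c⁻¹ = (a⁻¹) ^ τ * (b⁻¹) ^ (1 - τ) := by
    rw [hc, ENNReal.mul_inv, ENNReal.inv_rpow, ENNReal.inv_rpow]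
    · left; simp [ha0, hu1]
    · left; exact (ENNReal.rpow_ne_top_of_nonneg h0.le hu1)
  have hw' : ∀ t, {x | t < c⁻¹ * w x}.OrdConnected := by
    intro t
    have : {x | t < c⁻¹ * w x} = {x | c * t < w x} := by
      ext x
      simp only [mem_ofPred_eq]
      rw [mul_comm c⁻¹, ← div_eq_mul_inv, ENNReal.lt_div_iff_mul_lt (Or.inl hc0) (Or.inl hct),
        mul_comm]
    rw [this]; exact hwc _
  have := pl_norm (hu.const_mul a⁻¹) (hv.const_mul b⁻¹) (hw.const_mul c⁻¹) hw' h0 h1 ?_ ?_ ?_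
  · rw [lintegral_const_mul _ hu, lintegral_const_mul _ hv, lintegral_const_mul _ hw] at this
    have := (amgm_enn _ _ h0 h1).trans this
    rw [ENNReal.mul_rpow_of_nonneg _ _ h0.le, ENNReal.mul_rpow_of_nonneg _ _ h1'.le,
      mul_mul_mul_comm, ← hci] at this
    exact (ENNReal.mul_le_mul_iff_right (ENNReal.inv_ne_zero.2 hct) (ENNReal.inv_ne_top.2 hc0)).1 this
  · intro x y
    rw [ENNReal.mul_rpow_of_nonneg _ _ h0.le, ENNReal.mul_rpow_of_nonneg _ _ h1'.le,
      mul_mul_mul_comm, ← hci]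
    gcongr
    exact h x y
  · rw [← ENNReal.mul_iSup, ← ha]; exact ENNReal.inv_mul_cancel ha0 hu1
  · rw [← ENNReal.mul_iSup, ← hb]; exact ENNReal.inv_mul_cancel hb0 hv1

lemma pl_one {u v w : ℝ → ℝ≥0∞} (hu : Measurable u) (hv : Measurable v) (hw : Measurable w)
    (hwc : ∀ t, {x | t < w x}.OrdConnected) {τ : ℝ} (h0 : 0 < τ) (h1 : τ < 1)
    (h : ∀ x y, u x ^ τ * v y ^ (1 - τ) ≤ w (τ * x + (1 - τ) * y)) :
    (∫⁻ x, u x) ^ τ * (∫⁻ x, v x) ^ (1 - τ) ≤ ∫⁻ x, w x := by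
  have h1' : 0 < 1 - τ := by linarith
  have key : ∀ N : ℕ, (∫⁻ x, min (u x) N) ^ τ * (∫⁻ x, min (v x) N) ^ (1 - τ) ≤ ∫⁻ x, w x := by
    intro N
    apply pl_bdd (hu.min measurable_const) (hv.min measurable_const) hw hwc h0 h1
    · intro x y
      refine le_trans ?_ (h x y)
      gcongr <;> exact min_le_left _ _
    · exact ne_top_of_le_ne_top (ENNReal.natCast_ne_top N) (iSup_le fun x => min_le_right _ _)
    · exact ne_top_of_le_ne_top (ENNReal.natCast_ne_top N) (iSup_le fun x => min_le_right _ _)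
  have lim : ∀ {g : ℝ → ℝ≥0∞}, Measurable g → ∫⁻ x, g x = ⨆ N : ℕ, ∫⁻ x, min (g x) N := by
    intro g hg
    rw [← lintegral_iSup]
    · congr 1; ext x
      rw [← inf_iSup_eq]
      simp [ENNReal.iSup_natCast]
    · intro N; exact hg.min measurable_const
    · intro N M hNM x
      exact min_le_min le_rfl (by exact_mod_cast hNM)
  have mono : ∀ g : ℝ → ℝ≥0∞, Monotone (fun N : ℕ => ∫⁻ x, min (g x) N) := by
    intro g N M hNM
    apply lintegral_mono
    intro x
    exact min_le_min le_rfl (by exact_mod_cast hNM)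
  have rp : ∀ (s : ℝ) (hs : 0 < s) (F : ℕ → ℝ≥0∞), (⨆ N, F N) ^ s = ⨆ N, F N ^ s := by
    intro s hs F
    exact (ENNReal.orderIsoRpow s hs).map_iSup F
  rw [lim hu, lim hv, rp _ h0, rp _ h1', ENNReal.iSup_mul]
  refine iSup_le fun N => ?_
  rw [ENNReal.mul_iSup]
  refine iSup_le fun M => le_trans ?_ (key (max N M))
  gcongr
  · exact le_max_left N M
  · exact le_max_right N M

lemma LC.ordConnected {f : ℝ → ℝ≥0∞} (hf : LC f) (t : ℝ≥0∞) : {x | t < f x}.OrdConnected := by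
  apply Convex.ordConnected
  rw [convex_iff_forall_pos]
  intro x hx y hy a b ha hb hab
  obtain rfl : b = 1 - a := by linarith
  have h1 : a < 1 := by linarith
  refine lt_of_lt_of_le ?_ (hf x y a ha h1)
  rw [← ofReal_add_one_sub ha h1 t]
  exact ENNReal.mul_lt_mul (ENNReal.rpow_lt_rpow hx ha) (ENNReal.rpow_lt_rpow hy hb)

lemma LC.measurable {f : ℝ → ℝ≥0∞} (hf : LC f) : Measurable f :=
  measurable_of_Ioi fun t => (hf.ordConnected t).measurableSet

lemma LC.marginal_one {E : Type*} [AddCommGroup E] [Module ℝ E] {F : E × ℝ → ℝ≥0∞} (hF : LC F) :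
    LC (fun x => ∫⁻ s, F (x, s)) := by
  have sec : ∀ x, LC (fun s => F (x, s)) := by
    intro x s t τ h0 h1
    have := hF (x, s) (x, t) τ h0 h1
    simpa [← add_smul] using this
  intro x y τ h0 h1
  apply pl_one (sec x).measurable (sec y).measurable (sec _).measurable
    (sec _).ordConnected h0 h1
  intro s t
  simpa using hF (x, s) (y, t) τ h0 h1

lemma lintegral_finSucc {n : ℕ} {G : (Fin (n+1) → ℝ) → ℝ≥0∞} (hG : Measurable G) :
    ∫⁻ y, G y = ∫⁻ s : ℝ, ∫⁻ z : Fin n → ℝ, G (Fin.cons s z) := by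
  have h := (volume_preserving_piFinSuccAbove (fun _ : Fin (n+1) => ℝ) 0).symm
  rw [← h.lintegral_comp hG]
  rw [Measure.volume_eq_prod, lintegral_prod]
  · simp [MeasurableEquiv.piFinSuccAbove_symm_apply]
    rfl
  · exact (hG.comp (MeasurableEquiv.measurable _)).aemeasurable

lemma LC.marginal {n : ℕ} : ∀ {E : Type} [AddCommGroup E] [Module ℝ E]
    {F : E × (Fin n → ℝ) → ℝ≥0∞}, LC F → (∀ x, Measurable fun y => F (x, y)) →
    LC (fun x => ∫⁻ y, F (x, y)) := by
  induction n with
  | zero =>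
    intro E _ _ F hF _
    have : ∀ x, ∫⁻ y, F (x, y) = F (x, 0) := by
      intro x
      rw [volume_pi, Measure.pi_of_empty (x := 0), lintegral_dirac]
    simp_rw [this]
    intro x y τ h0 h1
    simpa using hF (x, 0) (y, 0) τ h0 h1
  | succ n ih =>
    intro E _ _ F hF hm
    have h1 : ∀ x, ∫⁻ y, F (x, y) = ∫⁻ s : ℝ, ∫⁻ z : Fin n → ℝ, F (x, Fin.cons s z) :=
      fun x => lintegral_finSucc (hm x)
    simp_rw [h1]
    refine LC.marginal_one (F := fun p : E × ℝ => ∫⁻ z : Fin n → ℝ, F (p.1, Fin.cons p.2 z)) ?_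
    refine ih (F := fun q : (E × ℝ) × (Fin n → ℝ) => F (q.1.1, Fin.cons q.1.2 q.2)) ?_ ?_
    · intro x y τ h0 h1
      have := hF (x.1.1, Fin.cons x.1.2 x.2) (y.1.1, Fin.cons y.1.2 y.2) τ h0 h1
      refine this.trans (le_of_eq ?_)
      congr 1
      simp only [Prod.fst_add, Prod.smul_fst, Prod.snd_add, Prod.smul_snd, Prod.smul_mk,
        Prod.mk_add_mk]
      congr 1
      ext i
      refine Fin.cases ?_ (fun i => ?_) i <;> simp
    · intro x
      apply (hm x.1).comp
      rw [measurable_pi_iff]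
      intro i
      refine Fin.cases ?_ (fun i => ?_) i
      · simp
      · simp only [Fin.cons_succ]; exact measurable_pi_apply i

lemma LC.submul {φ : ℝ → ℝ≥0∞} (h : LC φ) {s u : ℝ} (hs : 0 < s) (hu : 0 < u) :
    φ 0 * φ (s + u) ≤ φ s * φ u := by
  have hsu : 0 < s + u := by linarith
  have a0 : 0 < s / (s + u) := by positivity
  have a1 : s / (s + u) < 1 := by rw [div_lt_one hsu]; linarith
  have h1 := h (s + u) 0 _ a0 a1
  have h2 := h 0 (s + u) _ a0 a1
  have e1 : (s / (s + u)) • (s + u) + (1 - s / (s + u)) • (0:ℝ) = s := by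
    simp; field_simp
  have e2 : (s / (s + u)) • (0:ℝ) + (1 - s / (s + u)) • (s + u) = u := by
    simp; field_simp; ring
  rw [e1] at h1
  rw [e2] at h2
  refine le_trans (le_of_eq ?_) (mul_le_mul' h1 h2)
  have k1 := ofReal_add_one_sub a0 a1 (φ 0)
  have k2 := ofReal_add_one_sub a0 a1 (φ (s + u))
  set a := s / (s + u)
  calc φ 0 * φ (s + u)
      = (φ 0 ^ a * φ 0 ^ (1 - a)) * (φ (s + u) ^ a * φ (s + u) ^ (1 - a)) := by rw [k1, k2]
    _ = _ := by ring

lemma lint_shift {φ : ℝ → ℝ≥0∞} (s : ℝ) :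
    ∫⁻ u in Ioi (0:ℝ), φ (s + u) = ∫⁻ w in Ioi s, φ w := by
  rw [← lintegral_indicator measurableSet_Ioi, ← lintegral_indicator measurableSet_Ioi,
    ← lintegral_add_left_eq_self (fun w => (Ioi s).indicator φ w) s]
  congr 1; ext u
  simp [Set.indicator_apply]

/-- Tonelli on a triangle. -/
lemma lint_triangle {φ ψ : ℝ → ℝ≥0∞} (hφ : Measurable φ) (hψ : Measurable ψ) :
    ∫⁻ s in Ioi (0:ℝ), ψ s * ∫⁻ w in Ioi s, φ w
      = ∫⁻ w in Ioi (0:ℝ), (∫⁻ s in Ioo 0 w, ψ s) * φ w := by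
  have e1 : ∀ s, ψ s * ∫⁻ w in Ioi s, φ w = ∫⁻ w, (if s < w then ψ s * φ w else 0) := by
    intro s
    rw [← lintegral_const_mul _ hφ, ← lintegral_indicator measurableSet_Ioi]
    congr 1
  simp_rw [e1]
  rw [lintegral_lintegral_swap]
  · have e2 : ∀ w, ∫⁻ s in Ioi (0:ℝ), (if s < w then ψ s * φ w else 0)
        = (∫⁻ s in Ioo 0 w, ψ s) * φ w := by
      intro w
      rw [← lintegral_mul_const _ hψ, ← lintegral_indicator measurableSet_Ioi,
        ← lintegral_indicator measurableSet_Ioo]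
      congr 1; ext s; simp only [Set.indicator_apply, mem_Ioi, mem_Ioo]
      by_cases h1 : 0 < s <;> by_cases h2 : s < w <;> simp [h1, h2]
    simp_rw [e2]
    rw [← lintegral_indicator measurableSet_Ioi]
    congr 1; ext w
    by_cases hw : 0 < w
    · simp [hw]
    · simp [hw]
  · apply Measurable.aemeasurable
    apply Measurable.ite (measurableSet_lt measurable_fst measurable_snd)
    · exact (hψ.comp measurable_fst).mul (hφ.comp measurable_snd)
    · exact measurable_const

lemma lint_id (w : ℝ) (hw : 0 < w) :
    ∫⁻ s in Ioo 0 w, ENNReal.ofReal s = ENNReal.ofReal (w ^ 2 / 2) := by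
  rw [← ofReal_integral_eq_lintegral_ofReal]
  · rw [← integral_Ioc_eq_integral_Ioo, ← intervalIntegral.integral_of_le hw.le]
    simp
  · exact (continuous_id.integrableOn_Icc (a := 0) (b := w)).mono_set Ioo_subset_Icc_self
  · filter_upwards [ae_restrict_mem measurableSet_Ioo] with s hs using hs.1.le

/-- First moment against value at the endpoint and mass. -/
lemma LC.half_one {φ : ℝ → ℝ≥0∞} (h : LC φ) :
    φ 0 * ∫⁻ s in Ioi (0:ℝ), ENNReal.ofReal s * φ s ≤ (∫⁻ s in Ioi (0:ℝ), φ s) ^ 2 := by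
  have hm := h.measurable
  have e := lint_triangle hm (ψ := fun _ => 1) measurable_const
  have e' : ∫⁻ s in Ioi (0:ℝ), ENNReal.ofReal s * φ s
      = ∫⁻ s in Ioi (0:ℝ), ∫⁻ u in Ioi (0:ℝ), φ (s + u) := by
    simp_rw [lint_shift]
    simp only [one_mul] at e
    rw [e]
    simp
  have hm2 : Measurable (fun p : ℝ × ℝ => φ (p.1 + p.2)) :=
    hm.comp (measurable_fst.add measurable_snd)
  rw [e', ← lintegral_const_mul]
  · calc ∫⁻ s in Ioi (0:ℝ), φ 0 * ∫⁻ u in Ioi (0:ℝ), φ (s + u)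
        ≤ ∫⁻ s in Ioi (0:ℝ), φ s * ∫⁻ u in Ioi (0:ℝ), φ u := by
          apply setLIntegral_mono (hm.mul_const _)
          intro s hs
          rw [← lintegral_const_mul _ (by fun_prop), ← lintegral_const_mul _ hm]
          apply setLIntegral_mono (hm.const_mul _)
          intro u hu
          exact h.submul hs hu
      _ = _ := by rw [lintegral_mul_const _ hm, sq]
  · exact hm2.lintegral_prod_right'

lemma LC.tail {φ : ℝ → ℝ≥0∞} (h : LC φ) : LC (fun s => ∫⁻ w in Ioi s, φ w) := by
  have : ∀ s, ∫⁻ w in Ioi s, φ w = ∫⁻ w, (if s < w then φ w else 0) := by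
    intro s
    rw [← lintegral_indicator measurableSet_Ioi]
    congr 1
  simp_rw [this]
  refine LC.marginal_one (F := fun p : ℝ × ℝ => if p.1 < p.2 then φ p.2 else 0) ?_
  intro x y τ h0 h1
  have h1' : 0 < 1 - τ := by linarith
  by_cases hx : x.1 < x.2
  · by_cases hy : y.1 < y.2
    · have : (τ • x + (1 - τ) • y).1 < (τ • x + (1 - τ) • y).2 := by
        simp only [Prod.fst_add, Prod.smul_fst, Prod.snd_add, Prod.smul_snd, smul_eq_mul]
        have := mul_lt_mul_of_pos_left hx h0
        have := mul_lt_mul_of_pos_left hy h1'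
        linarith
      simp only [hx, hy, this, if_true]
      exact h _ _ τ h0 h1
    · simp [hy, h1]
  · simp [hx, h0]

/-- Second moment against first moment and mass. -/
lemma LC.half_two {φ : ℝ → ℝ≥0∞} (h : LC φ) :
    (∫⁻ s in Ioi (0:ℝ), φ s) * ∫⁻ s in Ioi (0:ℝ), ENNReal.ofReal (s ^ 2 / 2) * φ s
      ≤ (∫⁻ s in Ioi (0:ℝ), ENNReal.ofReal s * φ s) ^ 2 := by
  have hm := h.measurable
  have := h.tail.half_one
  rw [lint_triangle hm ENNReal.measurable_ofReal] at this
  have e := lint_triangle hm (ψ := fun _ => 1) measurable_const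
  simp only [one_mul] at e
  rw [e] at this
  have e1 : ∫⁻ w in Ioi (0:ℝ), (∫⁻ s in Ioo 0 w, ENNReal.ofReal s) * φ w
    = ∫⁻ s in Ioi (0:ℝ), ENNReal.ofReal (s ^ 2 / 2) * φ s := by
    apply setLIntegral_congr_fun measurableSet_Ioi
    intro w hw
    simp only [lint_id w hw]
  rw [e1] at this
  simpa using this

lemma half_real {Ω : Type*} [MeasurableSpace Ω] {μ : Measure Ω} [IsProbabilityMeasure μ]
    {Y : Ω → ℝ} (hY : Measurable Y) {φ : ℝ → ℝ≥0∞} (h : LC φ)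
    (hφ : ∀ ψ : ℝ → ℝ≥0∞, Measurable ψ → ∫⁻ ω, ψ (Y ω) ∂μ = ∫⁻ t, ψ t * φ t)
    (hY1 : Integrable Y μ) (hY2 : Integrable (fun ω => Y ω ^ 2) μ)
    {m : ℝ} (hm : 0 < m) (hmφ : ENNReal.ofReal m ≤ φ 0) :
    m * (∫ ω, max (Y ω) 0 ∂μ) ≤ (μ.real {ω | 0 < Y ω}) ^ 2 ∧
    μ.real {ω | 0 < Y ω} * (∫ ω, (max (Y ω) 0) ^ 2 ∂μ) ≤ 2 * (∫ ω, max (Y ω) 0 ∂μ) ^ 2 ∧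
    (μ.real {ω | 0 < Y ω} = 0 → ∫ ω, (max (Y ω) 0) ^ 2 ∂μ = 0) := by
  have i1 : Integrable (fun ω => max (Y ω) 0) μ := hY1.pos_part
  have i2 : Integrable (fun ω => (max (Y ω) 0) ^ 2) μ := by
    refine hY2.mono ((hY.max measurable_const).pow_const 2).aestronglyMeasurable ?_
    filter_upwards with ω
    rw [Real.norm_of_nonneg (sq_nonneg _), Real.norm_of_nonneg (sq_nonneg _)]
    rcases le_total (Y ω) 0 with h | h
    · simp [h]; positivity
    · simp [h]
  have hms : MeasurableSet {ω | 0 < Y ω} := measurableSet_lt measurable_const hY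
  have ea : ENNReal.ofReal (μ.real {ω | 0 < Y ω}) = ∫⁻ s in Ioi (0:ℝ), φ s := by
    rw [Measure.real, ENNReal.ofReal_toReal (measure_ne_top _ _), ← lintegral_indicator_one hms,
      ← lintegral_indicator measurableSet_Ioi]
    have := hφ ((Ioi 0).indicator 1) (measurable_one.indicator measurableSet_Ioi)
    refine Eq.trans ?_ (this.trans ?_)
    · congr 1
    · congr 1; ext t; by_cases ht : 0 < t <;> simp [ht]
  have eL : ENNReal.ofReal (∫ ω, max (Y ω) 0 ∂μ) = ∫⁻ s in Ioi (0:ℝ), ENNReal.ofReal s * φ s := by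
    rw [ofReal_integral_eq_lintegral_ofReal i1 (ae_of_all _ fun ω => le_max_right _ _),
      ← lintegral_indicator measurableSet_Ioi]
    have := hφ (fun t => ENNReal.ofReal (max t 0)) (by fun_prop)
    rw [this]
    congr 1; ext t; by_cases ht : 0 < t
    · simp [ht]
    · simp [ht]; left; linarith
  have eS : ENNReal.ofReal (∫ ω, (max (Y ω) 0) ^ 2 / 2 ∂μ)
      = ∫⁻ s in Ioi (0:ℝ), ENNReal.ofReal (s ^ 2 / 2) * φ s := by
    rw [ofReal_integral_eq_lintegral_ofReal (i2.div_const 2)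
      (ae_of_all _ fun ω => by positivity), ← lintegral_indicator measurableSet_Ioi]
    have := hφ (fun t => ENNReal.ofReal ((max t 0) ^ 2 / 2)) (by fun_prop)
    rw [this]
    congr 1; ext t; by_cases ht : 0 < t
    · simp [ht, ht.le]
    · simp [ht, not_lt.1 ht]
  have hL0 : 0 ≤ ∫ ω, max (Y ω) 0 ∂μ := integral_nonneg fun ω => le_max_right _ _
  refine ⟨?_, ?_, ?_⟩
  · have := h.half_one
    rw [← ea, ← eL] at this
    have := (mul_le_mul' hmφ le_rfl).trans this
    rwa [← ENNReal.ofReal_mul hm.le, ← ENNReal.ofReal_pow measureReal_nonneg,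
      ENNReal.ofReal_le_ofReal_iff (by positivity)] at this
  · have := h.half_two
    rw [← ea, ← eL, ← eS, ← ENNReal.ofReal_mul measureReal_nonneg, ← ENNReal.ofReal_pow hL0,
      ENNReal.ofReal_le_ofReal_iff (by positivity), integral_div] at this
    linarith
  · intro h0
    have : ∀ᵐ ω ∂μ, ¬ (0 < Y ω) := by
      rw [ae_iff]; simp only [not_not]
      exact (measureReal_eq_zero_iff).1 h0
    rw [integral_congr_ae (g := fun _ => (0:ℝ))]
    · simp
    · filter_upwards [this] with ω hω
      simp [not_lt.1 hω]

lemma side_bound {a L S m : ℝ} (ha : 0 ≤ a) (ha1 : a ≤ 1) (hL : 0 ≤ L) (hm : 0 < m)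
    (h1 : m * L ≤ a ^ 2) (h2 : a * S ≤ 2 * L ^ 2) (h3 : a = 0 → S = 0) :
    m ^ 2 * (S - L ^ 2) ≤ 2 * a ^ 3 - a ^ 4 := by
  rcases ha.eq_or_lt with h | h
  · have hS := h3 h.symm
    have : m ^ 2 * L ^ 2 ≥ 0 := by positivity
    subst hS; rw [← h]; nlinarith
  · have hsq : (m * L) ^ 2 ≤ (a ^ 2) ^ 2 := pow_le_pow_left₀ (by positivity) h1 2
    have e1 : a * (m ^ 2 * (S - L ^ 2)) ≤ (2 - a) * (m * L) ^ 2 := by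
      nlinarith [mul_le_mul_of_nonneg_left h2 (sq_nonneg m)]
    have e2 : (2 - a) * (m * L) ^ 2 ≤ (2 - a) * (a ^ 2) ^ 2 :=
      mul_le_mul_of_nonneg_left hsq (by linarith)
    have e3 : a * (m ^ 2 * (S - L ^ 2)) ≤ a * (2 * a ^ 3 - a ^ 4) := by nlinarith
    exact le_of_mul_le_mul_left e3 h

lemma final_poly {a b : ℝ} (ha : 0 ≤ a) (hb : 0 ≤ b) (hab : a + b ≤ 1) :
    2 * a ^ 3 - a ^ 4 + (2 * b ^ 3 - b ^ 4) + 2 * a ^ 2 * b ^ 2 ≤ 1 := by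
  set s := a + b with hs
  have hs0 : 0 ≤ s := by positivity
  have hab0 : 0 ≤ a * b := by positivity
  have e : 2 * a ^ 3 - a ^ 4 + (2 * b ^ 3 - b ^ 4) + 2 * a ^ 2 * b ^ 2
     = 2 * s ^ 3 - s ^ 4 - a * b * (6 * s - 4 * s ^ 2) := by rw [hs]; ring
  rw [e]
  have : 0 ≤ a * b * (6 * s - 4 * s ^ 2) := mul_nonneg hab0 (by nlinarith)
  have : 2 * s ^ 3 - s ^ 4 ≤ 1 := by nlinarith [mul_nonneg hs0 hs0, mul_nonneg (mul_nonneg hs0 hs0) hs0, sq_nonneg (s^2 - s), sq_nonneg (s-1)]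
  linarith

lemma dens_le_one {Ω : Type*} [MeasurableSpace Ω] {μ : Measure Ω} [IsProbabilityMeasure μ]
    {X : Ω → ℝ} (hX : Measurable X) {φ : ℝ → ℝ≥0∞} (h : LC φ)
    (hφ : ∀ ψ : ℝ → ℝ≥0∞, Measurable ψ → ∫⁻ ω, ψ (X ω) ∂μ = ∫⁻ t, ψ t * φ t)
    (hX1 : Integrable X μ) (hX2 : Integrable (fun ω => X ω ^ 2) μ)
    (hmean : ∫ ω, X ω ∂μ = 0) (hvar : ∫ ω, X ω ^ 2 ∂μ = 1) (c : ℝ) : φ c ≤ 1 := by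
  by_contra hcon
  rw [not_le] at hcon
  obtain ⟨m, hm0, hm1⟩ : ∃ m : ℝ, 1 < m ∧ ENNReal.ofReal m ≤ φ c := by
    obtain ⟨q, hq1, hq2⟩ := ENNReal.lt_iff_exists_nnreal_btwn.1 hcon
    refine ⟨q, by exact_mod_cast hq1, ?_⟩
    rw [ENNReal.ofReal_coe_nnreal]; exact hq2.le
  have hmp : 0 < m := by linarith
  have iY : Integrable (fun ω => X ω - c) μ := hX1.sub (integrable_const c)
  have iY2 : Integrable (fun ω => (X ω - c) ^ 2) μ := by
    have : (fun ω => (X ω - c) ^ 2) = fun ω => X ω ^ 2 - (2 * c) * X ω + c ^ 2 := by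
      ext; ring
    rw [this]
    exact (hX2.sub (hX1.const_mul _)).add (integrable_const _)
  have iZ : Integrable (fun ω => c - X ω) μ := (integrable_const c).sub hX1
  have iZ2 : Integrable (fun ω => (c - X ω) ^ 2) μ := by
    have : (fun ω => (c - X ω) ^ 2) = fun ω => (X ω - c) ^ 2 := by
      ext; ring
    rwa [this]
  have lcR : LC (fun s => φ (s + c)) := by
    intro x y τ h0 h1
    have := h (x + c) (y + c) τ h0 h1
    refine this.trans (le_of_eq ?_)
    congr 1; simp; ring
  have lcL : LC (fun s => φ (c - s)) := by
    intro x y τ h0 h1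
    have := h (c - x) (c - y) τ h0 h1
    refine this.trans (le_of_eq ?_)
    congr 1; simp; ring
  have R := half_real (hX.sub_const c) lcR (fun ψ hψ => by
    have := hφ (fun t => ψ (t - c)) (by fun_prop)
    rw [this, ← lintegral_add_right_eq_self _ c]
    simp) iY iY2 hmp (by simpa using hm1)
  have L := half_real (hX.const_sub c) lcL (fun ψ hψ => by
    have := hφ (fun t => ψ (c - t)) (by fun_prop)
    rw [this, ← lintegral_sub_left_eq_self _ c]
    simp) iZ iZ2 hmp (by simpa using hm1)
  set a := μ.real {ω | 0 < X ω - c}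
  set b := μ.real {ω | 0 < c - X ω}
  set LR := ∫ ω, max (X ω - c) 0 ∂μ
  set LL := ∫ ω, max (c - X ω) 0 ∂μ
  set SR := ∫ ω, (max (X ω - c) 0) ^ 2 ∂μ
  set SL := ∫ ω, (max (c - X ω) 0) ^ 2 ∂μ
  have hLR : 0 ≤ LR := integral_nonneg fun ω => le_max_right _ _
  have hLL : 0 ≤ LL := integral_nonneg fun ω => le_max_right _ _
  have sqi : ∀ {Y : Ω → ℝ}, Measurable Y → Integrable (fun ω => Y ω ^ 2) μ →
      Integrable (fun ω => (max (Y ω) 0) ^ 2) μ := by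
    intro Y hY hY2
    refine hY2.mono ((hY.max measurable_const).pow_const 2).aestronglyMeasurable ?_
    filter_upwards with ω
    rw [Real.norm_of_nonneg (sq_nonneg _), Real.norm_of_nonneg (sq_nonneg _)]
    rcases le_total (Y ω) 0 with h | h
    · simp [h]; positivity
    · simp [h]
  have e1 : LR - LL = -c := by
    have i1 : Integrable (fun ω => max (X ω - c) 0) μ := iY.pos_part
    have i2 : Integrable (fun ω => max (c - X ω) 0) μ := iZ.pos_part
    rw [← integral_sub i1 i2]
    have : ∀ ω, max (X ω - c) 0 - max (c - X ω) 0 = X ω - c := by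
      intro ω
      rcases le_total (X ω) c with h | h
      · rw [max_eq_right (by linarith), max_eq_left (by linarith)]; ring
      · rw [max_eq_left (by linarith), max_eq_right (by linarith)]; ring
    simp_rw [this]
    rw [integral_sub hX1 (integrable_const c), hmean]; simp
  have e2 : SR + SL = 1 + c ^ 2 := by
    rw [← integral_add (sqi (hX.sub_const c) iY2) (sqi (hX.const_sub c) iZ2)]
    have : ∀ ω, (max (X ω - c) 0) ^ 2 + (max (c - X ω) 0) ^ 2
        = X ω ^ 2 - (2 * c) * X ω + c ^ 2 := by
      intro ω
      rcases le_total (X ω) c with h | h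
      · rw [max_eq_right (by linarith), max_eq_left (by linarith)]; ring
      · rw [max_eq_left (by linarith), max_eq_right (by linarith)]; ring
    simp_rw [this]
    have i3 : Integrable (fun ω => X ω ^ 2 - (2 * c) * X ω) μ := hX2.sub (hX1.const_mul _)
    rw [integral_add i3 (integrable_const _),
      integral_sub hX2 (hX1.const_mul _), integral_const_mul, hmean, hvar]
    simp
  have hab : a + b ≤ 1 := by
    have hd : Disjoint {ω | 0 < X ω - c} {ω | 0 < c - X ω} := by
      rw [Set.disjoint_left]
      intro ω h1 h2
      simp only [mem_ofPred_eq] at h1 h2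
      linarith
    rw [← measureReal_union hd (measurableSet_lt measurable_const (hX.const_sub c))]
    exact measureReal_le_one
  have ha : 0 ≤ a := measureReal_nonneg
  have hb : 0 ≤ b := measureReal_nonneg
  have s1 := side_bound ha (by linarith) hLR hmp R.1 R.2.1 R.2.2
  have s2 := side_bound hb (by linarith) hLL hmp L.1 L.2.1 L.2.2
  have s3 : (m * LR) * (m * LL) ≤ a ^ 2 * b ^ 2 :=
    mul_le_mul R.1 L.1 (by positivity) (by positivity)
  have s4 := final_poly ha hb hab
  have : (SR - LR ^ 2) + (SL - LL ^ 2) + 2 * LR * LL = 1 := by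
    have : c = LL - LR := by linarith
    rw [this] at e2; linarith
  nlinarith

lemma regularize {n : ℕ} (f : Euc n → ℝ) (hf : IsLogConcaveFn f) :
    ∃ g : Euc n → ℝ, IsLogConcaveFn g ∧ Measurable g ∧ IsOpen {x | 0 < g x} ∧
      ContinuousOn g {x | 0 < g x} ∧ Convex ℝ {x | 0 < g x} ∧
      volume.withDensity (fun x => ENNReal.ofReal (f x))
        = volume.withDensity (fun x => ENNReal.ofReal (g x)) := by
  classical
  obtain ⟨f0, hfl⟩ := hf
  set K : Set (Euc n) := {x | 0 < f x} with hK
  have hKc : Convex ℝ K := by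
    rw [convex_iff_forall_pos]
    intro x hx y hy a b ha hb hab
    obtain rfl : b = 1 - a := by linarith
    refine lt_of_lt_of_le ?_ (hfl x y a ha.le (by linarith))
    exact mul_pos (Real.rpow_pos_of_pos hx _) (Real.rpow_pos_of_pos hy _)
  set U := interior K with hU
  have hUK : U ⊆ K := interior_subset
  have hUo : IsOpen U := isOpen_interior
  have hUc : Convex ℝ U := hKc.interior
  set g : Euc n → ℝ := U.piecewise f 0 with hg
  have gin : ∀ x ∈ U, g x = f x := fun x hx => by simp [hg, hx]
  have gout : ∀ x, x ∉ U → g x = 0 := fun x hx => by simp [hg, hx]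
  have hset : {x | 0 < g x} = U := by
    ext x
    by_cases hx : x ∈ U
    · simp only [mem_ofPred_eq, gin x hx, hx, iff_true]
      exact hUK hx
    · simp [gout x hx, hx]
  have hconc : ConcaveOn ℝ U (fun x => Real.log (f x)) := by
    rw [concaveOn_iff_forall_pos]
    refine ⟨hUc, ?_⟩
    intro x hx y hy a b ha hb hab
    obtain rfl : b = 1 - a := by linarith
    have hx' : 0 < f x := hUK hx
    have hy' : 0 < f y := hUK hy
    have := hfl x y a ha.le (by linarith)
    have := Real.log_le_log (mul_pos (Real.rpow_pos_of_pos hx' _) (Real.rpow_pos_of_pos hy' _)) this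
    rw [Real.log_mul (Real.rpow_pos_of_pos hx' _).ne' (Real.rpow_pos_of_pos hy' _).ne',
      Real.log_rpow hx', Real.log_rpow hy'] at this
    simpa using this
  have hcf : ContinuousOn f U := by
    have := (hconc.continuousOn hUo).rexp
    refine this.congr ?_
    intro x hx
    exact (Real.exp_log (hUK hx)).symm
  refine ⟨g, ⟨?_, ?_⟩, ?_, ?_, ?_, ?_, ?_⟩
  · intro x
    by_cases hx : x ∈ U
    · rw [gin x hx]; exact f0 x
    · rw [gout x hx]
  · intro x y τ h0 h1
    rcases h0.eq_or_lt with rfl | h0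
    · simp
    rcases h1.eq_or_lt with rfl | h1
    · simp
    by_cases hx : x ∈ U
    · by_cases hy : y ∈ U
      · rw [gin x hx, gin y hy, gin _ (hUc hx hy h0.le (by linarith) (by linarith))]
        exact hfl x y τ h0.le h1.le
      · rw [gout y hy, Real.zero_rpow (by linarith), mul_zero]
        by_cases hz : τ • x + (1 - τ) • y ∈ U
        · rw [gin _ hz]; exact f0 _
        · rw [gout _ hz]
    · rw [gout x hx, Real.zero_rpow (by linarith), zero_mul]
      by_cases hz : τ • x + (1 - τ) • y ∈ U
      · rw [gin _ hz]; exact f0 _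
      · rw [gout _ hz]
  · exact ContinuousOn.measurable_piecewise hcf continuousOn_const hUo.measurableSet
  · rw [hset]; exact hUo
  · rw [hset]; exact hcf.congr gin
  · rw [hset]; exact hUc
  · apply withDensity_congr_ae
    have := hKc.addHaar_frontier volume
    rw [measure_eq_zero_iff_ae_notMem] at this
    filter_upwards [this] with x hx
    by_cases hxU : x ∈ U
    · rw [gin x hxU]
    · rw [gout x hxU]
      have : x ∉ K := by
        intro hxK
        exact hx ⟨subset_closure hxK, hxU⟩
      have : f x = 0 := le_antisymm (not_lt.1 this) (f0 x)
      rw [this]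

section moments
variable {n : ℕ} {μ : Measure (Euc n)} [IsProbabilityMeasure μ]

lemma int_mul (hiso : ∀ i j : Fin n, ∫ x, x i * x j ∂μ = if i = j then 1 else 0) (i j : Fin n) :
    Integrable (fun x : Euc n => x i * x j) μ := by
  have hsq : ∀ i, Integrable (fun x : Euc n => x i * x i) μ := by
    intro i
    by_contra h
    have := hiso i i
    rw [integral_undef h] at this
    simp at this
  have hm : ∀ i : Fin n, Measurable (fun x : Euc n => x i) := fun i => by fun_prop
  refine ((hsq i).add (hsq j)).mono' ((hm i).mul (hm j)).aestronglyMeasurable ?_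
  filter_upwards with x
  simp only [Pi.add_apply, Real.norm_eq_abs]
  rw [abs_le]
  constructor <;> nlinarith [sq_nonneg (x i + x j), sq_nonneg (x i - x j)]

lemma int_id (hiso : ∀ i j : Fin n, ∫ x, x i * x j ∂μ = if i = j then 1 else 0) :
    Integrable (fun x : Euc n => x) μ := by
  have h1 : Integrable (fun x : Euc n => 1 + ∑ i, x i * x i) μ :=
    (integrable_const 1).add (integrable_finsetSum _ fun i _ => int_mul hiso i i)
  refine h1.mono' measurable_id.aestronglyMeasurable ?_
  filter_upwards with x
  have : ‖x‖ ^ 2 = ∑ i, x i * x i := by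
    rw [EuclideanSpace.norm_sq_eq]
    congr 1; ext i; rw [Real.norm_eq_abs, sq_abs, sq]
  rw [← this]
  nlinarith [sq_nonneg (‖x‖ - 1)]

lemma int_inner (hiso : ∀ i j : Fin n, ∫ x, x i * x j ∂μ = if i = j then 1 else 0) (v : Euc n) :
    Integrable (fun x : Euc n => inner ℝ v x) μ := (int_id hiso).const_inner v

lemma mean_inner (hcent : ∫ x, x ∂μ = 0)
    (hiso : ∀ i j : Fin n, ∫ x, x i * x j ∂μ = if i = j then 1 else 0) (v : Euc n) :
    ∫ x, inner ℝ v x ∂μ = 0 := by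
  rw [integral_inner (int_id hiso), hcent, inner_zero_right]

lemma inner_sq_eq (v x : Euc n) :
    (inner ℝ v x : ℝ) ^ 2 = ∑ i, ∑ j, (v i * v j) * (x i * x j) := by
  rw [PiLp.inner_apply, sq, Finset.sum_mul_sum]
  refine Finset.sum_congr rfl fun i _ => Finset.sum_congr rfl fun j _ => ?_
  simp; ring

lemma int_inner_sq (hiso : ∀ i j : Fin n, ∫ x, x i * x j ∂μ = if i = j then 1 else 0) (v : Euc n) :
    Integrable (fun x : Euc n => (inner ℝ v x : ℝ) ^ 2) μ := by
  simp_rw [inner_sq_eq]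
  exact integrable_finsetSum _ fun i _ => integrable_finsetSum _ fun j _ =>
    (int_mul hiso i j).const_mul _

lemma var_inner (hiso : ∀ i j : Fin n, ∫ x, x i * x j ∂μ = if i = j then 1 else 0) (v : Euc n) :
    ∫ x, (inner ℝ v x : ℝ) ^ 2 ∂μ = ‖v‖ ^ 2 := by
  simp_rw [inner_sq_eq]
  rw [integral_finsetSum _ fun i _ => integrable_finsetSum _ fun j _ =>
    (int_mul hiso i j).const_mul _]
  rw [EuclideanSpace.norm_sq_eq]
  refine Finset.sum_congr rfl fun i _ => ?_
  rw [integral_finsetSum _ fun j _ => (int_mul hiso i j).const_mul _]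
  simp_rw [integral_const_mul, hiso]
  simp [sq]

end moments

lemma slab {m : ℕ} (f : Euc (m+1) → ℝ) (μ : Measure (Euc (m+1)))
    [IsProbabilityMeasure μ] (hf : IsLogConcaveFn f) (hfm : Measurable f)
    (hμ : μ = volume.withDensity (fun x => ENNReal.ofReal (f x)))
    (hcent : ∫ x, x ∂μ = 0)
    (hiso : ∀ i j : Fin (m+1), ∫ x, x i * x j ∂μ = if i = j then 1 else 0)
    (θ : Euc (m+1)) (hθ : ‖θ‖ = 1) (ρ : ℝ) :
    μ {x | |(inner ℝ θ x : ℝ)| ≤ ρ} ≤ ENNReal.ofReal (2 * ρ) := by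
  obtain ⟨b, hb⟩ : ∃ b : OrthonormalBasis (Fin (m+1)) ℝ (Euc (m+1)), ∀ i ∈ ({0} : Set (Fin (m+1))),
      b i = (fun _ => θ) i := by
    apply Orthonormal.exists_orthonormalBasis_extension_of_card_eq (by simp)
    constructor
    · intro i; simpa using hθ
    · intro i j hij; exact absurd (Subsingleton.elim i j) hij
  have hb0 : b 0 = θ := hb 0 rfl
  set T : (Fin (m+1) → ℝ) → Euc (m+1) := fun y => b.repr.symm (WithLp.toLp 2 y) with hT
  have hTp : MeasurePreserving T volume volume :=
    b.measurePreserving_repr_symm.comp (PiLp.volume_preserving_toLp (Fin (m+1)))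
  have hTm : Measurable T := hTp.measurable
  have hT0 : ∀ y, inner ℝ θ (T y) = y 0 := by
    intro y
    rw [← hb0, ← b.repr_apply_apply, hT]
    simp
  have hTl : ∀ (τ : ℝ) y z, T (τ • y + (1 - τ) • z) = τ • T y + (1 - τ) • T z := by
    intro τ y z; simp [hT]
  set φ : ℝ → ℝ≥0∞ := fun t => ∫⁻ z : Fin m → ℝ, ENNReal.ofReal (f (T (Fin.cons t z))) with hφ
  have hcons : ∀ t : ℝ, Measurable (fun z : Fin m → ℝ => (Fin.cons t z : Fin (m+1) → ℝ)) := by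
    intro t
    rw [measurable_pi_iff]
    intro i
    refine Fin.cases ?_ (fun i => ?_) i
    · simp
    · simp only [Fin.cons_succ]; exact measurable_pi_apply i
  have lcφ : LC φ := by
    refine LC.marginal (E := ℝ) (F := fun p => ENNReal.ofReal (f (T (Fin.cons p.1 p.2)))) ?_ ?_
    · intro p q τ h0 h1
      have := hf.2 (T (Fin.cons p.1 p.2)) (T (Fin.cons q.1 q.2)) τ h0.le h1.le
      rw [← hTl] at this
      rw [ENNReal.ofReal_rpow_of_nonneg (hf.1 _) h0.le,
        ENNReal.ofReal_rpow_of_nonneg (hf.1 _) (by linarith),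
        ← ENNReal.ofReal_mul (Real.rpow_nonneg (hf.1 _) _)]
      apply ENNReal.ofReal_le_ofReal
      refine this.trans (le_of_eq ?_)
      congr 2
      ext i
      refine Fin.cases ?_ (fun i => ?_) i <;> simp
    · intro t
      exact (hfm.comp (hTm.comp (hcons t))).ennreal_ofReal
  have law : ∀ ψ : ℝ → ℝ≥0∞, Measurable ψ →
      ∫⁻ x, ψ (inner ℝ θ x) ∂μ = ∫⁻ t, ψ t * φ t := by
    intro ψ hψ
    have hψm : Measurable (fun x : Euc (m+1) => ψ (inner ℝ θ x)) :=
      hψ.comp (by fun_prop)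
    rw [hμ, lintegral_withDensity_eq_lintegral_mul _ hfm.ennreal_ofReal hψm,
      ← hTp.lintegral_comp (hfm.ennreal_ofReal.mul hψm), lintegral_finSucc]
    · congr 1; ext t
      rw [hφ]
      dsimp only
      rw [← lintegral_const_mul]
      · congr 1; ext z
        simp only [Pi.mul_apply, hT0, Fin.cons_zero, mul_comm]
      · exact (hfm.comp (hTm.comp (hcons t))).ennreal_ofReal
    · exact (hfm.ennreal_ofReal.mul hψm).comp hTm
  have hle := dens_le_one (μ := μ) (X := fun x => inner ℝ θ x) (by fun_prop) lcφ law
    (int_inner hiso θ) (int_inner_sq hiso θ) (mean_inner hcent hiso θ)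
    (by rw [var_inner hiso, hθ]; norm_num)
  have hms : MeasurableSet {x : Euc (m+1) | |(inner ℝ θ x : ℝ)| ≤ ρ} :=
    measurableSet_le (by fun_prop) measurable_const
  calc μ {x | |(inner ℝ θ x : ℝ)| ≤ ρ}
      = ∫⁻ x, (Icc (-ρ) ρ).indicator 1 (inner ℝ θ x : ℝ) ∂μ := by
        rw [← lintegral_indicator_one hms]
        congr 1; ext x
        simp only [Set.indicator_apply, mem_ofPred_eq, abs_le, mem_Icc, Pi.one_apply]
    _ = ∫⁻ t, (Icc (-ρ) ρ).indicator 1 t * φ t := law _ (measurable_one.indicator measurableSet_Icc)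
    _ ≤ ∫⁻ t, (Icc (-ρ) ρ).indicator 1 t := by
        apply lintegral_mono
        intro t
        exact mul_le_of_le_one_right' (hle t)
    _ = ENNReal.ofReal (2 * ρ) := by
        rw [lintegral_indicator_one measurableSet_Icc, Real.volume_Icc]
        congr 1; ring

lemma zero_mem {n : ℕ} (f : Euc n → ℝ) (μ : Measure (Euc n)) [IsProbabilityMeasure μ]
    (hfm : Measurable f) (hf0 : ∀ x, 0 ≤ f x)
    (hμ : μ = volume.withDensity (fun x => ENNReal.ofReal (f x)))
    (hcent : ∫ x, x ∂μ = 0)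
    (hiso : ∀ i j : Fin n, ∫ x, x i * x j ∂μ = if i = j then 1 else 0)
    (ho : IsOpen {x | 0 < f x}) (hc : Convex ℝ {x | 0 < f x}) : 0 < f 0 := by
  by_contra hcon
  have hnot : (0 : Euc n) ∉ {x | 0 < f x} := hcon
  obtain ⟨F, hF⟩ := geometric_hahn_banach_open_point hc ho hnot
  set v := (InnerProductSpace.toDual ℝ (Euc n)).symm F with hv
  have hvF : ∀ x, inner ℝ v x = F x := fun x => InnerProductSpace.toDual_symm_apply
  have hae : ∀ᵐ x ∂μ, 0 < f x := by
    rw [ae_iff, hμ, withDensity_apply_eq_zero hfm.ennreal_ofReal]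
    have : {x | ENNReal.ofReal (f x) ≠ 0} ∩ {a | ¬ 0 < f a} = ∅ := by
      ext x
      simp only [mem_inter_iff, mem_ofPred_eq, mem_empty_iff_false, iff_false, not_and, not_not]
      intro h
      by_contra h'
      exact h (ENNReal.ofReal_eq_zero.2 (not_lt.1 h'))
    rw [this]; simp
  have hneg : ∀ᵐ x ∂μ, inner ℝ v x < (0:ℝ) := by
    filter_upwards [hae] with x hx
    rw [hvF]
    simpa using hF x hx
  have h0 : ∫ x, -(inner ℝ v x : ℝ) ∂μ = 0 := by
    rw [integral_neg, mean_inner hcent hiso, neg_zero]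
  rw [integral_eq_zero_iff_of_nonneg_ae] at h0
  · have : ∀ᵐ x ∂μ, False := by
      filter_upwards [hneg, h0] with x h1 h2
      simp at h2
      linarith
    rw [Filter.eventually_false_iff_eq_bot, ae_eq_bot] at this
    exact IsProbabilityMeasure.ne_zero μ this
  · filter_upwards [hneg] with x hx
    simp only [Pi.zero_apply]; linarith
  · exact (int_inner hiso v).neg

lemma exists_majorant {n : ℕ} (f : Euc n → ℝ) (hf : IsLogConcaveFn f)
    (ho : IsOpen {x | 0 < f x}) (hcont : ContinuousOn f {x | 0 < f x})
    (hc : Convex ℝ {x | 0 < f x}) (h0 : 0 < f 0) :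
    ∃ v : Euc n, ∀ x, f x ≤ f 0 * Real.exp (inner ℝ v x) := by
  set U : Set (Euc n) := {x | 0 < f x} with hU
  have hconc : ConcaveOn ℝ U (fun x => Real.log (f x)) := by
    rw [concaveOn_iff_forall_pos]
    refine ⟨hc, ?_⟩
    intro x hx y hy a b ha hb hab
    obtain rfl : b = 1 - a := by linarith
    have hx' : 0 < f x := hx
    have hy' : 0 < f y := hy
    have := hf.2 x y a ha.le (by linarith)
    have := Real.log_le_log (mul_pos (Real.rpow_pos_of_pos hx' _) (Real.rpow_pos_of_pos hy' _)) this
    rw [Real.log_mul (Real.rpow_pos_of_pos hx' _).ne' (Real.rpow_pos_of_pos hy' _).ne',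
      Real.log_rpow hx', Real.log_rpow hy'] at this
    simpa using this
  set W : Set (Euc n × ℝ) := {p | p.1 ∈ U ∧ p.2 < Real.log (f p.1)} with hW
  have hWc : Convex ℝ W := hconc.convex_strict_hypograph
  have hlc : ContinuousOn (fun x => Real.log (f x)) U := hcont.log (fun x hx => ne_of_gt hx)
  have hWo : IsOpen W := by
    have h1 : IsOpen (Prod.fst ⁻¹' U : Set (Euc n × ℝ)) := ho.preimage continuous_fst
    have h2 : ContinuousOn (fun p : Euc n × ℝ => Real.log (f p.1) - p.2) (Prod.fst ⁻¹' U) :=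
      (hlc.comp continuousOn_fst (fun p hp => hp)).sub continuousOn_snd
    have h3 := h2.isOpen_inter_preimage h1 (isOpen_Ioi (a := (0:ℝ)))
    convert h3 using 1
    ext p
    simp [hW]
  have hnot : ((0 : Euc n), Real.log (f 0)) ∉ W := fun h => lt_irrefl _ h.2
  obtain ⟨F, hF⟩ := geometric_hahn_banach_open_point hWc hWo hnot
  set β := F (0, 1) with hβ
  have hdec : ∀ x t, F (x, t) = F (x, 0) + t * β := by
    intro x t
    have : ((x, t) : Euc n × ℝ) = (x, 0) + t • (0, 1) := by simp
    rw [this, map_add, map_smul, smul_eq_mul]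
  have hβ0 : 0 < β := by
    have := hF (0, Real.log (f 0) - 1) ⟨h0, by simp⟩
    rw [hdec 0 (_ - 1), hdec 0 (Real.log (f 0))] at this
    linarith
  set G : StrongDual ℝ (Euc n) := F.comp (ContinuousLinearMap.inl ℝ (Euc n) ℝ) with hG
  have hGx : ∀ x, G x = F (x, 0) := fun x => by simp [hG]
  refine ⟨(InnerProductSpace.toDual ℝ (Euc n)).symm (-(β⁻¹) • G), fun x => ?_⟩
  rw [InnerProductSpace.toDual_symm_apply]
  by_cases hx : x ∈ U
  · have hx' : 0 < f x := hx
    have key : Real.log (f x) ≤ Real.log (f 0) - β⁻¹ * F (x, 0) := by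
      apply le_of_forall_lt
      intro t ht
      have := hF (x, t) ⟨hx, ht⟩
      rw [hdec x t, hdec 0 (Real.log (f 0))] at this
      have h00 : F ((0 : Euc n), (0:ℝ)) = 0 := map_zero F
      rw [h00] at this
      have h5 : β⁻¹ * (F (x, 0) + t * β) < β⁻¹ * (0 + Real.log (f 0) * β) :=
        mul_lt_mul_of_pos_left this (by positivity)
      have e1 : β⁻¹ * (F (x, 0) + t * β) = β⁻¹ * F (x, 0) + t := by field_simp
      have e2 : β⁻¹ * (0 + Real.log (f 0) * β) = Real.log (f 0) := by field_simp; ring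
      rw [e1, e2] at h5
      linarith
    calc f x = Real.exp (Real.log (f x)) := (Real.exp_log hx').symm
      _ ≤ Real.exp (Real.log (f 0) - β⁻¹ * F (x, 0)) := Real.exp_le_exp.2 key
      _ = f 0 * Real.exp (- (β⁻¹ * F (x, 0))) := by
          rw [sub_eq_add_neg, Real.exp_add, Real.exp_log h0]
      _ = _ := by simp [hGx]
  · have : f x = 0 := le_antisymm (not_lt.1 hx) (hf.1 x)
    rw [this]; positivity

lemma sup_bound {n : ℕ} (f : Euc n → ℝ) (μ : Measure (Euc n)) [IsProbabilityMeasure μ]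
    (hf : IsLogConcaveFn f) (hfm : Measurable f)
    (hμ : μ = volume.withDensity (fun x => ENNReal.ofReal (f x)))
    (hcent : ∫ x, x ∂μ = 0)
    (hiso : ∀ i j : Fin n, ∫ x, x i * x j ∂μ = if i = j then 1 else 0)
    (h0 : 0 < f 0) (v : Euc n) (hv : ∀ x, f x ≤ f 0 * Real.exp (inner ℝ v x)) (z : Euc n) :
    f z ≤ f 0 * Real.exp n := by
  rcases (hf.1 z).eq_or_lt with hz | hz
  · rw [← hz]; positivity
  have hfin : ∀ᵐ x : Euc n ∂volume, ENNReal.ofReal (f x) < ⊤ := ae_of_all _ fun x =>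
    ENNReal.ofReal_lt_top
  have tr : ∀ g : Euc n → ℝ, ∫ x, g x ∂μ = ∫ x, f x * g x := by
    intro g
    rw [hμ, integral_withDensity_eq_integral_toReal_smul hfm.ennreal_ofReal hfin]
    simp [ENNReal.toReal_ofReal (hf.1 _)]
  have tri : ∀ g : Euc n → ℝ, Integrable g μ → Integrable (fun x => f x * g x) volume := by
    intro g hg
    rw [hμ, integrable_withDensity_iff_integrable_smul' hfm.ennreal_ofReal hfin] at hg
    simpa [ENNReal.toReal_ofReal (hf.1 _)] using hg
  have if1 : Integrable f volume := by simpa using tri (fun _ => 1) (integrable_const 1)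
  have f1 : ∫ x, f x = 1 := by
    have := tr (fun _ => 1)
    simpa using this.symm
  set l := Real.log (f z / f 0) with hl
  have hr : 0 < f z / f 0 := by positivity
  have step : ∀ s : ℝ, 0 < s → s < 1 → s * l ≤ n := by
    intro s hs0 hs1
    have hs1' : 0 < 1 - s := by linarith
    have pt : ∀ x, (f z / f 0) ^ (1 - s) * (f x * (1 - (1 - s) * inner ℝ v x))
        ≤ f (s • x + (1 - s) • z) := by
      intro x
      refine le_trans ?_ (hf.2 x z s hs0.le hs1.le)
      rcases (hf.1 x).eq_or_lt with hx | hx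
      · rw [← hx, Real.zero_rpow hs0.ne']; simp
      rw [Real.div_rpow hz.le h0.le]
      have hA : 0 < f 0 ^ (1 - s) := Real.rpow_pos_of_pos h0 _
      have hB : 0 < f z ^ (1 - s) := Real.rpow_pos_of_pos hz _
      have k1 : f x ^ (1 - s) ≤ f 0 ^ (1 - s) * Real.exp ((1 - s) * inner ℝ v x) := by
        calc f x ^ (1 - s) ≤ (f 0 * Real.exp (inner ℝ v x)) ^ (1 - s) :=
              Real.rpow_le_rpow hx.le (hv x) hs1'.le
          _ = _ := by
              rw [Real.mul_rpow h0.le (Real.exp_pos _).le, ← Real.exp_mul]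
              ring_nf
      have k2 : 1 - (1 - s) * inner ℝ v x ≤ Real.exp (-((1 - s) * inner ℝ v x)) := by
        have := Real.add_one_le_exp (-((1 - s) * inner ℝ v x))
        linarith
      have k3 : f x = f x ^ s * f x ^ (1 - s) := by
        rw [← Real.rpow_add hx]; simp
      have k4 : f x * (1 - (1 - s) * inner ℝ v x) ≤ f x ^ s * f 0 ^ (1 - s) := by
        calc f x * (1 - (1 - s) * inner ℝ v x)
            ≤ f x * Real.exp (-((1 - s) * inner ℝ v x)) := by gcongr
          _ = f x ^ s * f x ^ (1 - s) * Real.exp (-((1 - s) * inner ℝ v x)) := by rw [← k3]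
          _ ≤ f x ^ s * (f 0 ^ (1 - s) * Real.exp ((1 - s) * inner ℝ v x))
              * Real.exp (-((1 - s) * inner ℝ v x)) := by gcongr
          _ = f x ^ s * f 0 ^ (1 - s) * (Real.exp ((1 - s) * inner ℝ v x)
              * Real.exp (-((1 - s) * inner ℝ v x))) := by ring
          _ = _ := by rw [← Real.exp_add]; simp
      calc f z ^ (1 - s) / f 0 ^ (1 - s) * (f x * (1 - (1 - s) * inner ℝ v x))
          ≤ f z ^ (1 - s) / f 0 ^ (1 - s) * (f x ^ s * f 0 ^ (1 - s)) := by gcongr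
        _ = f x ^ s * f z ^ (1 - s) := by field_simp
    have iv : Integrable (fun x : Euc n => 1 - (1 - s) * (inner ℝ v x : ℝ)) μ :=
      (integrable_const 1).sub ((int_inner hiso v).const_mul _)
    have ish : Integrable (fun x => f (x + (1 - s) • z)) volume := if1.comp_add_right _
    have int := integral_mono ((tri _ iv).const_mul ((f z / f 0) ^ (1 - s)))
      (ish.comp_smul hs0.ne') pt
    rw [integral_const_mul, ← tr, integral_sub (integrable_const 1)
      ((int_inner hiso v).const_mul _), integral_const_mul, mean_inner hcent hiso] at int
    rw [Measure.integral_comp_smul volume (fun x => f (x + (1 - s) • z)) s,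
      integral_add_right_eq_self, f1] at int
    simp only [integral_const, probReal_univ, smul_eq_mul, mul_one, mul_zero, sub_zero,
      finrank_euclideanSpace, Fintype.card_fin] at int
    rw [abs_of_pos (by positivity)] at int
    have lg := Real.log_le_log (Real.rpow_pos_of_pos hr _) int
    rw [Real.log_rpow hr, Real.log_inv, Real.log_pow, ← hl] at lg
    have ls : -Real.log s ≤ s⁻¹ - 1 := by
      have := Real.log_le_sub_one_of_pos (inv_pos.2 hs0)
      rwa [Real.log_inv] at this
    have : (1 - s) * l ≤ n * (s⁻¹ - 1) := by
      have := mul_le_mul_of_nonneg_left ls (Nat.cast_nonneg (α := ℝ) n)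
      linarith
    have h7 : s * ((1 - s) * l) ≤ s * (n * (s⁻¹ - 1)) := mul_le_mul_of_nonneg_left this hs0.le
    have h8 : s * (n * (s⁻¹ - 1)) = (1 - s) * n := by field_simp
    rw [h8] at h7
    refine le_of_mul_le_mul_left (a := 1 - s) ?_ hs1'
    linarith
  have hln : l ≤ n := by
    have ht : Tendsto (fun s : ℝ => s * l) (nhdsWithin 1 (Iio 1)) (nhds (1 * l)) :=
      ((continuous_id.mul continuous_const).tendsto 1).mono_left nhdsWithin_le_nhds
    rw [one_mul] at ht
    refine le_of_tendsto ht ?_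
    filter_upwards [Ioo_mem_nhdsLT (show (0:ℝ) < 1 by norm_num)] with s hs
    exact step s hs.1 hs.2
  have : f z / f 0 ≤ Real.exp n := by
    rw [← Real.exp_log hr]; exact Real.exp_le_exp.2 hln
  rw [div_le_iff₀ h0] at this
  linarith

lemma dilate_bound {n : ℕ} (f : Euc n → ℝ) (μ : Measure (Euc n))
    (hf : IsLogConcaveFn f) (hfm : Measurable f)
    (hμ : μ = volume.withDensity (fun x => ENNReal.ofReal (f x)))
    (h0 : 0 < f 0) (hs : ∀ z, f z ≤ f 0 * Real.exp n)
    (A : Set (Euc n)) (hA : IsClosed A) (t : ℝ) (ht : 1 < t) :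
    μ (t • A) ≤ ENNReal.ofReal (t ^ n * Real.exp (n * (t - 1))) * μ A := by
  have ht0 : 0 < t := by linarith
  have hAt : MeasurableSet (t • A) := (hA.smul₀ t).measurableSet
  have pt : ∀ x, f (t • x) ≤ Real.exp (n * (t - 1)) * f x := by
    intro x
    rcases (hf.1 (t • x)).eq_or_lt with hx | hx
    · rw [← hx]; exact mul_nonneg (Real.exp_pos _).le (hf.1 x)
    have := hf.2 (t • x) 0 t⁻¹ (by positivity) (inv_le_one_of_one_le₀ ht.le)
    rw [smul_smul, inv_mul_cancel₀ ht0.ne', one_smul, smul_zero, add_zero] at this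
    have hpos : 0 < f (t • x) ^ t⁻¹ * f 0 ^ (1 - t⁻¹) :=
      mul_pos (Real.rpow_pos_of_pos hx _) (Real.rpow_pos_of_pos h0 _)
    have hfx : 0 < f x := hpos.trans_le this
    have k := Real.log_le_log hpos this
    rw [Real.log_mul (Real.rpow_pos_of_pos hx _).ne' (Real.rpow_pos_of_pos h0 _).ne',
      Real.log_rpow hx, Real.log_rpow h0] at k
    have k2 := Real.log_le_log hfx (hs x)
    rw [Real.log_mul h0.ne' (Real.exp_pos _).ne', Real.log_exp] at k2
    have k3 : t * (t⁻¹ * Real.log (f (t • x)) + (1 - t⁻¹) * Real.log (f 0)) ≤ t * Real.log (f x) :=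
      mul_le_mul_of_nonneg_left k ht0.le
    have k4 : t * (t⁻¹ * Real.log (f (t • x)) + (1 - t⁻¹) * Real.log (f 0))
        = Real.log (f (t • x)) + (t - 1) * Real.log (f 0) := by field_simp
    rw [k4] at k3
    have k5 : Real.log (f (t • x)) ≤ n * (t - 1) + Real.log (f x) := by
      nlinarith [mul_le_mul_of_nonneg_left k2 (show 0 ≤ t - 1 by linarith)]
    have := Real.exp_le_exp.2 k5
    rwa [Real.exp_log hx, Real.exp_add, Real.exp_log hfx] at this
  have hmf : Measurable (fun x => ENNReal.ofReal (f x)) := hfm.ennreal_ofReal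
  have cv : ∀ G : Euc n → ℝ≥0∞, Measurable G →
      ∫⁻ x, G x = ENNReal.ofReal (t ^ n) * ∫⁻ x, G (t • x) := by
    intro G hG
    have h1 := Measure.map_addHaar_smul (volume : Measure (Euc n)) ht0.ne'
    have h2 : ∫⁻ x, G (t • x) = ∫⁻ y, G y ∂(Measure.map (fun x => t • x) volume) :=
      (lintegral_map hG (measurable_const_smul t)).symm
    rw [h2, h1, lintegral_smul_measure, smul_eq_mul, ← mul_assoc,
      ← ENNReal.ofReal_mul (by positivity), finrank_euclideanSpace, Fintype.card_fin,
      abs_of_pos (by positivity), mul_inv_cancel₀ (by positivity)]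
    simp
  rw [hμ, withDensity_apply _ hAt, withDensity_apply _ hA.measurableSet,
    ← lintegral_indicator hAt, ← lintegral_indicator hA.measurableSet,
    cv _ (hmf.indicator hAt), ENNReal.ofReal_mul (by positivity), mul_assoc]
  gcongr
  rw [← lintegral_const_mul _ (hmf.indicator hA.measurableSet)]
  apply lintegral_mono
  intro x
  by_cases hx : x ∈ A
  · have : t • x ∈ t • A := smul_mem_smul_set hx
    simp only [Set.indicator_of_mem this, Set.indicator_of_mem hx]
    rw [← ENNReal.ofReal_mul (Real.exp_pos _).le]
    exact ENNReal.ofReal_le_ofReal (pt x)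
  · have : t • x ∉ t • A := by
      rwa [smul_mem_smul_set_iff₀ ht0.ne']
    simp [Set.indicator_of_notMem this]

lemma zero_mem_interior_of_symm {n : ℕ} (A : Set (Euc n)) (hA : IsConvexBody A) (hsymm : A = -A) :
    (0 : Euc n) ∈ interior A := by
  obtain ⟨x, hx⟩ := hA.2.2
  have hx2 : -x ∈ interior A := by
    have h := (Homeomorph.neg (Euc n)).preimage_interior A
    have h2 : (Homeomorph.neg (Euc n)) ⁻¹' A = A := by
      conv_rhs => rw [hsymm]
      rfl
    rw [h2] at h
    rw [← h]
    simpa using hx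
  have := hA.1.interior hx hx2 (by norm_num : (0 : ℝ) ≤ 1 / 2) (by norm_num : (0 : ℝ) ≤ 1 / 2)
    (by norm_num)
  simpa using this

lemma ball_subset {m : ℕ} (f : Euc (m+1) → ℝ) (μ : Measure (Euc (m+1)))
    [IsProbabilityMeasure μ] (hf : IsLogConcaveFn f) (hfm : Measurable f)
    (hμ : μ = volume.withDensity (fun x => ENNReal.ofReal (f x)))
    (hcent : ∫ x, x ∂μ = 0)
    (hiso : ∀ i j : Fin (m+1), ∫ x, x i * x j ∂μ = if i = j then 1 else 0)
    (A : Set (Euc (m+1))) (hA : IsConvexBody A) (hsymm : A = -A) :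
    closedBall (0 : Euc (m+1)) ((μ A).toReal / 2) ⊆ A := by
  intro y hy
  by_contra hyA
  have h0 : (0 : Euc (m+1)) ∈ A := interior_subset (zero_mem_interior_of_symm A hA hsymm)
  obtain ⟨F, u, hF, hu⟩ := geometric_hahn_banach_closed_point hA.1 hA.2.1.isClosed hyA
  set v := (InnerProductSpace.toDual ℝ (Euc (m+1))).symm F with hv
  have hvF : ∀ x, inner ℝ v x = F x := fun x => InnerProductSpace.toDual_symm_apply
  have hu0 : 0 < u := by simpa using hF 0 h0
  have hyn : ‖y‖ ≤ (μ A).toReal / 2 := by simpa using hy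
  have hle : u < ‖v‖ * ‖y‖ := by
    calc u < F y := hu
      _ = inner ℝ v y := (hvF y).symm
      _ ≤ _ := real_inner_le_norm v y
  have hvpos : 0 < ‖v‖ := by
    rcases (norm_nonneg v).eq_or_lt with h | h
    · rw [← h] at hle; linarith
    · exact h
  have hs := slab f μ hf hfm hμ hcent hiso (‖v‖⁻¹ • v) (by
    rw [norm_smul, norm_inv, norm_norm, inv_mul_cancel₀ hvpos.ne']) (u / ‖v‖)
  have hsub : A ⊆ {x | |(inner ℝ (‖v‖⁻¹ • v) x : ℝ)| ≤ u / ‖v‖} := by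
    intro a ha
    have ha2 : -a ∈ A := by rw [hsymm]; simpa using ha
    have h1 := hF a ha
    have h2 := hF (-a) ha2
    rw [map_neg] at h2
    have h3 : |F a| ≤ u := abs_le.2 ⟨by linarith, h1.le⟩
    change |(inner ℝ (‖v‖⁻¹ • v) a : ℝ)| ≤ u / ‖v‖
    rw [real_inner_smul_left, hvF, abs_mul, abs_of_pos (inv_pos.2 hvpos), div_eq_inv_mul]
    gcongr
  have h4 := (measure_mono hsub).trans hs
  have h5 : (μ A).toReal ≤ 2 * (u / ‖v‖) :=
    ENNReal.toReal_le_of_le_ofReal (by positivity) h4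
  have h6 : u / ‖v‖ < ‖y‖ := by rw [div_lt_iff₀ hvpos]; linarith
  linarith

theorem symmetric_max_perimeter_upper_bound {n : ℕ} (f : Euc n → ℝ) (μ : Measure (Euc n))
    [IsProbabilityMeasure μ]
    (hf : IsLogConcaveFn f)
    (hμ : μ = volume.withDensity (fun x => ENNReal.ofReal (f x)))
    (hcent : ∫ x, x ∂μ = 0)
    (hiso : ∀ i j : Fin n, ∫ x, x i * x j ∂μ = if i = j then 1 else 0)
    (A : Set (Euc n)) (hA : IsConvexBody A) (hsymm : A = -A) :
    muPerim μ A ≤ 4 * n := by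
  obtain ⟨g, hg, hgm, hgo, hgc, hgconv, heq⟩ := regularize f hf
  rw [heq] at hμ
  have hz := zero_mem_interior_of_symm A hA hsymm
  have hz' : (0 : Euc n) ∈ A := interior_subset hz
  have hAm : MeasurableSet A := hA.2.1.isClosed.measurableSet
  rcases n with _ | m
  · have hAu : A = univ := by
      ext x; simp [Subsingleton.elim x 0, hz']
    simp [muPerim, hAu]
  have hg0 := zero_mem g μ hgm hg.1 hμ hcent hiso hgo hgconv
  obtain ⟨v, hv⟩ := exists_majorant g hg hgo hgc hgconv hg0
  have hs := sup_bound g μ hg hgm hμ hcent hiso hg0 v hv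
  have hp : 0 < (μ A).toReal := by
    refine ENNReal.toReal_pos ?_ (measure_ne_top μ A)
    intro h
    rw [hμ, withDensity_apply_eq_zero hgm.ennreal_ofReal] at h
    have h1 : 0 < volume (interior A ∩ {x | 0 < g x}) :=
      (isOpen_interior.inter hgo).measure_pos volume ⟨0, hz, hg0⟩
    have h2 : volume (interior A ∩ {x | 0 < g x}) ≤ 0 := by
      rw [← h]
      refine measure_mono ?_
      rintro x ⟨hx, hx2⟩
      refine ⟨?_, interior_subset hx⟩
      change ENNReal.ofReal (g x) ≠ 0
      exact (ENNReal.ofReal_pos.2 hx2).ne'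
    exact absurd h1 (not_lt.2 h2)
  set p := (μ A).toReal with hpdef
  have hball := ball_subset g μ hg hgm hμ hcent hiso A hA hsymm
  rw [← hpdef] at hball
  set G : ℝ → ℝ := fun ε => p * ((1 + ε / (p / 2)) ^ (m + 1) *
    Real.exp ((m + 1 : ℕ) * (ε / (p / 2)))) with hG
  have hder : HasDerivAt G (4 * ((m + 1 : ℕ) : ℝ)) 0 := by
    have e1 : HasDerivAt (fun ε : ℝ => ε / (p / 2)) (1 / (p / 2)) 0 :=
      (hasDerivAt_id (0 : ℝ)).div_const _
    have e2 := (e1.const_add 1).pow (m + 1)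
    have e3 := (e1.const_mul ((m + 1 : ℕ) : ℝ)).exp
    have e4 := (e2.mul e3).const_mul p
    refine e4.congr_deriv ?_
    simp
    field_simp
    ring
  have hlim : Tendsto (fun ε : ℝ => (G ε - p) / ε) (nhdsWithin 0 (Ioi 0))
      (nhds (4 * ((m + 1 : ℕ) : ℝ))) := by
    have := hder.tendsto_slope_zero_right
    refine this.congr fun ε => ?_
    have hG0 : G 0 = p := by simp [hG]
    rw [zero_add, hG0, smul_eq_mul, div_eq_inv_mul]
  have hbd : ∀ ε : ℝ, 0 < ε →
      (μ ((A + closedBall (0 : Euc (m+1)) ε) \ A)).toReal / ε ≤ (G ε - p) / ε := by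
    intro ε hε
    have hr : 0 < p / 2 := by positivity
    set t := 1 + ε / (p / 2) with ht
    have ht1 : 1 < t := by have : 0 < ε / (p / 2) := by positivity
                           linarith
    have hsub : A + closedBall (0 : Euc (m+1)) ε ⊆ t • A := by
      rw [ht, hA.1.add_smul zero_le_one (by positivity), one_smul]
      refine add_subset_add_left ?_
      intro y hy
      have hy' : ‖y‖ ≤ ε := by simpa using hy
      refine ⟨(ε / (p / 2))⁻¹ • y, hball ?_, ?_⟩
      · rw [mem_closedBall_zero_iff, norm_smul, norm_inv, Real.norm_of_nonneg (by positivity),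
          inv_div, div_mul_eq_mul_div, div_le_iff₀ hε]
        gcongr
      · exact smul_inv_smul₀ (by positivity) y
    have hAt : A ⊆ t • A := by
      refine subset_trans ?_ hsub
      intro a ha
      exact ⟨a, ha, 0, by simp [hε.le], by simp⟩
    have hd := dilate_bound g μ hg hgm hμ hg0 hs A hA.2.1.isClosed t ht1
    have hd2 : (μ (t • A)).toReal ≤ G ε := by
      have := ENNReal.toReal_mono (ENNReal.mul_ne_top ENNReal.ofReal_ne_top (measure_ne_top μ A)) hd
      rw [ENNReal.toReal_mul, ENNReal.toReal_ofReal (by positivity), ← hpdef] at this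
      refine this.trans (le_of_eq ?_)
      rw [hG, ht]
      simp only [add_sub_cancel_left]
      ring
    have hd3 : (μ ((A + closedBall (0 : Euc (m+1)) ε) \ A)).toReal ≤ (μ (t • A)).toReal - p := by
      have h1 : (μ ((A + closedBall (0 : Euc (m+1)) ε) \ A)).toReal ≤ (μ ((t • A) \ A)).toReal :=
        ENNReal.toReal_mono (measure_ne_top _ _) (measure_mono (sdiff_subset_sdiff_left hsub))
      rw [measure_sdiff hAt hAm.nullMeasurableSet (measure_ne_top _ _),
        ENNReal.toReal_sub_of_le (measure_mono hAt) (measure_ne_top _ _)] at h1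
      exact h1
    gcongr
    linarith
  have hev : ∀ᶠ ε : ℝ in nhdsWithin 0 (Ioi 0),
      (μ ((A + closedBall (0 : Euc (m+1)) ε) \ A)).toReal / ε ≤ (G ε - p) / ε := by
    filter_upwards [self_mem_nhdsWithin] with ε hε using hbd ε hε
  unfold muPerim
  rw [← hlim.liminf_eq]
  refine liminf_le_liminf hev ?_ hlim.isCoboundedUnder_ge
  refine ⟨0, ?_⟩
  rw [eventually_map]
  filter_upwards [self_mem_nhdsWithin] with ε hε
  have : (0 : ℝ) < ε := hε
  positivity
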